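/- Voronoi cell volume lower bound: let Z_1,...,Z_m ∈ R^d, let x ∈ R^d, and let V(x) denote the Voronoi cell {z : nearest neighbor of z among Z_1,...,Z_m equals nearest neighbor of x}. Let W_(1) ≤ W_(2) denote the two smallest distances ||Z_i - x||, and set Δ = W_(2) - W_(1). If P is a probability measure with P(B(y,t)) ≥ c_3 t^d for all t ∈ (0,T_1) and y in the support, and if Δ ≤ 2T_1, then P(V(x)) ≥ (c_3/2^d) Δ^d. -/

import Mathlib

open MeasureTheory Metric Finset

/-- Voronoi cell volume lower bound: if `x` lies in the Voronoi cell of `Z k` (i.e. `k` is an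
argmin of the distances), Δ = W₍₂₎ - W₍₁₎ is the gap between the two smallest distances
‖Z i - x‖, and the measure P satisfies P(B(y,t)) ≥ c₃ t^d for t ∈ (0,T₁) and points y of the
support, then whenever Δ ≤ 2T₁, the Voronoi cell of `Z k` has P-measure at least
(c₃/2^d) Δ^d. -/
theorem stmt_10 (d m : ℕ) (hd : 0 < d) (hm : 2 ≤ m)
    (Z : Fin m → EuclideanSpace ℝ (Fin d)) (x : EuclideanSpace ℝ (Fin d))
    (P : Measure (EuclideanSpace ℝ (Fin d))) [IsProbabilityMeasure P]
    (S : Set (EuclideanSpace ℝ (Fin d))) (hZS : ∀ i, Z i ∈ S)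
    (c₃ T₁ : ℝ) (hc₃ : 0 < c₃) (hT₁ : 0 < T₁)
    (hball : ∀ y ∈ S, ∀ t : ℝ, 0 < t → t < T₁ →
      ENNReal.ofReal (c₃ * t ^ d) ≤ P (ball y t))
    (k : Fin m) (hk : ∀ i, ‖Z k - x‖ ≤ ‖Z i - x‖)
    (hne : ((Finset.univ : Finset (Fin m)).erase k).Nonempty)
    (Δ : ℝ)
    (hΔ : Δ = ((Finset.univ : Finset (Fin m)).erase k).inf' hne (fun i => ‖Z i - x‖)
            - ‖Z k - x‖)
    (hΔT : Δ ≤ 2 * T₁) :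
    ENNReal.ofReal (c₃ / 2 ^ d * Δ ^ d)
      ≤ P {z | ∀ i, ‖z - Z k‖ ≤ ‖z - Z i‖} := by
  have hΔi : ∀ i, i ≠ k → Δ ≤ ‖Z i - Z k‖ := by
    intro i hi
    have h1 : ((Finset.univ : Finset (Fin m)).erase k).inf' hne (fun i => ‖Z i - x‖)
        ≤ ‖Z i - x‖ :=
      Finset.inf'_le (fun i => ‖Z i - x‖) (Finset.mem_erase.2 ⟨hi, Finset.mem_univ i⟩)
    have h2 : ‖Z i - x‖ ≤ ‖Z i - Z k‖ + ‖Z k - x‖ := norm_sub_le_norm_sub_add_norm_sub _ _ _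
    linarith
  have hΔ0 : 0 ≤ Δ := by
    have h1 : ‖Z k - x‖ ≤
        ((Finset.univ : Finset (Fin m)).erase k).inf' hne (fun i => ‖Z i - x‖) :=
      Finset.le_inf' _ _ (fun i _ => hk i)
    linarith
  rcases hΔ0.eq_or_lt with h0 | hpos
  · rw [← h0, zero_pow hd.ne']
    simp
  have key : ∀ t : ℝ, 0 < t → t < Δ / 2 →
      ENNReal.ofReal (c₃ * t ^ d) ≤ P {z | ∀ i, ‖z - Z k‖ ≤ ‖z - Z i‖} := by
    intro t ht0 ht
    refine (hball (Z k) (hZS k) t ht0 (by linarith)).trans (measure_mono ?_)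
    intro z hz i
    rw [mem_ball, dist_eq_norm] at hz
    by_cases hi : i = k
    · rw [hi]
    have h1 := hΔi i hi
    have h2 : ‖Z i - Z k‖ ≤ ‖Z i - z‖ + ‖z - Z k‖ := norm_sub_le_norm_sub_add_norm_sub _ _ _
    rw [norm_sub_rev (Z i) z] at h2
    linarith
  have hlim : Filter.Tendsto (fun t : ℝ => ENNReal.ofReal (c₃ * t ^ d))
      (nhdsWithin (Δ / 2) (Set.Iio (Δ / 2))) (nhds (ENNReal.ofReal (c₃ * (Δ / 2) ^ d))) := by
    have hc : Continuous (fun t : ℝ => ENNReal.ofReal (c₃ * t ^ d)) :=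
      ENNReal.continuous_ofReal.comp (by fun_prop)
    exact (hc.tendsto _).mono_left nhdsWithin_le_nhds
  have heq : c₃ / 2 ^ d * Δ ^ d = c₃ * (Δ / 2) ^ d := by
    rw [div_pow]; ring
  rw [heq]
  refine le_of_tendsto hlim ?_
  filter_upwards [Ioo_mem_nhdsLT (half_pos hpos)] with t ht
  exact key t ht.1 ht.2
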